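/- (Euler–Jacobi formula) Let f_1,…,f_n ∈ ℂ[x_1,…,x_n] with deg f_i = d_i, and suppose that the system has no zeros at infinity, i.e., the top-degree homogeneous components f_1^0,…,f_n^0 (where f_i^0 is the homogeneous part of f_i of degree d_i) have no common zero in ℂ^n other than the origin. Let J_f = det(∂f_i/∂x_j)_{1 ≤ i,j ≤ n} be the Jacobian determinant, and assume that every common zero ξ ∈ ℂ^n of f_1,…,f_n satisfies J_f(ξ) ≠ 0 (so in particular the common zero set V(f) is finite). Then for every polynomial h ∈ ℂ[x_1,…,x_n] with deg h < ρ := Σ_{i=1}^n d_i − n, the global residue Σ_{ξ ∈ V(f)} h(ξ)/J_f(ξ) equals 0. -/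

import Mathlib

open MvPolynomial

namespace MvPolynomial

section DegreeBounds

variable {K σ ι : Type*} [Field K] [Fintype ι]

/-- The polynomials `∑ i, a i * f i` all of whose terms `a i * f i` have total degree at
most `k`. -/
def boundedCombinations (f : ι → MvPolynomial σ K) (k : ℕ) :
    Submodule K (MvPolynomial σ K) where
  carrier := {p | ∃ a : ι → MvPolynomial σ K,
    p = ∑ i, a i * f i ∧ ∀ i, (a i * f i).totalDegree ≤ k}
  zero_mem' := ⟨0, by simp⟩
  add_mem' := by
    rintro _ _ ⟨a, rfl, ha⟩ ⟨b, rfl, hb⟩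
    refine ⟨a + b, by simp [add_mul, Finset.sum_add_distrib], fun i => ?_⟩
    rw [Pi.add_apply, add_mul]
    exact (totalDegree_add _ _).trans (max_le (ha i) (hb i))
  smul_mem' := by
    rintro c _ ⟨a, rfl, ha⟩
    refine ⟨c • a, by simp [Finset.smul_sum], fun i => ?_⟩
    rw [Pi.smul_apply, smul_mul_assoc]
    exact (totalDegree_smul_le _ _).trans (ha i)

theorem boundedCombinations_mono (f : ι → MvPolynomial σ K) {k l : ℕ} (hkl : k ≤ l) :
    boundedCombinations f k ≤ boundedCombinations f l :=
  fun _ ⟨a, hp, ha⟩ => ⟨a, hp, fun i => (ha i).trans hkl⟩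

theorem mem_span_of_mem_boundedCombinations {f : ι → MvPolynomial σ K} {k : ℕ}
    {p : MvPolynomial σ K} (hp : p ∈ boundedCombinations f k) :
    p ∈ Ideal.span (Set.range f) := by
  obtain ⟨a, rfl, -⟩ := hp
  exact Ideal.sum_mem _ fun i _ =>
    Ideal.mul_mem_left _ _ (Ideal.subset_span (Set.mem_range_self i))

theorem exists_mem_boundedCombinations {f : ι → MvPolynomial σ K} {p : MvPolynomial σ K}
    (hp : p ∈ Ideal.span (Set.range f)) : ∃ k, p ∈ boundedCombinations f k := by
  obtain ⟨a, ha⟩ := (Ideal.mem_span_range_iff_exists_fun).1 hp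
  exact ⟨Finset.univ.sup fun i => (a i * f i).totalDegree, a, ha.symm,
    fun i => Finset.le_sup (f := fun i => (a i * f i).totalDegree) (Finset.mem_univ i)⟩

theorem exists_le_boundedCombinations (f : ι → MvPolynomial σ K)
    {S : Submodule K (MvPolynomial σ K)} (hS : S.FG)
    (hSf : ∀ p ∈ S, p ∈ Ideal.span (Set.range f)) : ∃ k, S ≤ boundedCombinations f k := by
  obtain ⟨s, rfl⟩ := hS
  have hex : ∀ p : MvPolynomial σ K, ∃ k, p ∈ s → p ∈ boundedCombinations f k := fun p => by
    by_cases hp : p ∈ s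
    · obtain ⟨k, hk⟩ := exists_mem_boundedCombinations (hSf p (Submodule.subset_span hp))
      exact ⟨k, fun _ => hk⟩
    · exact ⟨0, fun h => absurd h hp⟩
  choose k hk using hex
  exact ⟨s.sup k, Submodule.span_le.2 fun p hp =>
    boundedCombinations_mono f (Finset.le_sup hp) (hk p hp)⟩

theorem totalDegree_sub_homogeneousComponent_lt {p : MvPolynomial σ K} {k : ℕ} (hk : 0 < k)
    (hp : p.totalDegree ≤ k) : (p - homogeneousComponent k p).totalDegree < k := by
  refine (Finset.sup_lt_iff (by simpa using hk)).2 fun s hs => ?_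
  rw [mem_support_iff, coeff_sub, coeff_homogeneousComponent] at hs
  have hsk : s.degree ≠ k := fun h => by simp [h] at hs
  rw [if_neg hsk, sub_zero] at hs
  have h1 := (le_totalDegree (mem_support_iff.2 hs)).trans hp
  exact lt_of_le_of_ne h1 hsk

theorem homogeneousComponent_mul_of_isHomogeneous {p q : MvPolynomial σ K} {d : ℕ}
    (hq : q.IsHomogeneous d) (m : ℕ) :
    homogeneousComponent m (p * q) =
      if d ≤ m then homogeneousComponent (m - d) p * q else 0 := by
  classical
  let _ := gradedAlgebra (σ := σ) (R := K)
  have hdec : ∀ n (r : MvPolynomial σ K),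
      (DirectSum.decompose (homogeneousSubmodule σ K) r n : MvPolynomial σ K) =
        homogeneousComponent n r := fun n r => decomposition.decompose'_apply r n
  simpa only [hdec] using DirectSum.coe_decompose_mul_of_right_mem (homogeneousSubmodule σ K) m
    (a := p) ((mem_homogeneousSubmodule d q).2 hq)

theorem exists_homogeneous_combination {g : ι → MvPolynomial σ K} {d : ι → ℕ}
    (hg : ∀ i, (g i).IsHomogeneous (d i)) {p : MvPolynomial σ K} {m : ℕ}
    (hp : p.IsHomogeneous m) (hpg : p ∈ Ideal.span (Set.range g)) :
    ∃ c : ι → MvPolynomial σ K, p = ∑ i, c i * g i ∧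
      ∀ i, c i = 0 ∨ (c i).totalDegree + d i ≤ m := by
  obtain ⟨a, ha⟩ := (Ideal.mem_span_range_iff_exists_fun).1 hpg
  refine ⟨fun i => if d i ≤ m then homogeneousComponent (m - d i) (a i) else 0, ?_, fun i => ?_⟩
  · rw [← homogeneousComponent_eq_self hp, ← ha, map_sum]
    refine Finset.sum_congr rfl fun i _ => ?_
    rw [homogeneousComponent_mul_of_isHomogeneous (hg i), ite_mul, zero_mul]
  · by_cases hi : d i ≤ m
    · right
      simp only [if_pos hi]
      have := (homogeneousComponent_isHomogeneous (m - d i) (a i)).totalDegree_le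
      omega
    · left
      simp [hi]

variable [Fintype σ]

theorem mem_span_of_pow_mem {I : Ideal (MvPolynomial σ K)} {M : ℕ} (hM : ∀ j, X j ^ M ∈ I)
    {p : MvPolynomial σ K} {k : ℕ} (hp : p.IsHomogeneous k) (hk : Fintype.card σ * M < k) :
    p ∈ I := by
  rw [p.as_sum]
  refine Ideal.sum_mem _ fun s hs => ?_
  have hsk : ∑ j, s j = k := by
    rw [← Finsupp.degree_eq_sum]
    rw [Finsupp.degree_eq_weight_one]
    exact hp (mem_support_iff.1 hs)
  obtain ⟨j, hj⟩ : ∃ j, M ≤ s j := by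
    by_contra! hlt
    have := Finset.sum_le_sum fun j (_ : j ∈ Finset.univ) => (hlt j).le
    simp only [Finset.sum_const, Finset.card_univ, smul_eq_mul] at this
    omega
  have : monomial s (coeff s p) =
      monomial (s - Finsupp.single j M) (coeff s p) * X j ^ M := by
    rw [X_pow_eq_monomial, monomial_mul, mul_one, tsub_add_cancel_of_le]
    simpa using hj
  rw [this]
  exact I.mul_mem_left _ (hM j)

theorem restrictTotalDegree_le_sup (f : ι → MvPolynomial σ K) (hf : ∀ i, 0 < (f i).totalDegree)
    {M : ℕ} (hM : ∀ j, X j ^ M ∈ Ideal.span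
      (Set.range fun i => homogeneousComponent (f i).totalDegree (f i))) (k : ℕ) :
    restrictTotalDegree σ K k ≤
      boundedCombinations f k ⊔ restrictTotalDegree σ K (Fintype.card σ * M) := by
  induction k with
  | zero =>
    refine le_sup_of_le_right fun p hp => ?_
    rw [mem_restrictTotalDegree] at hp ⊢
    omega
  | succ k ih =>
    intro p hp
    rw [mem_restrictTotalDegree] at hp
    by_cases hk : k + 1 ≤ Fintype.card σ * M
    · exact Submodule.mem_sup_right ((mem_restrictTotalDegree _ _ _).2 (hp.trans hk))
    obtain ⟨c, hc, hcd⟩ := exists_homogeneous_combination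
      (fun i => homogeneousComponent_isHomogeneous (f i).totalDegree (f i))
      (homogeneousComponent_isHomogeneous (k + 1) p)
      (mem_span_of_pow_mem hM (homogeneousComponent_isHomogeneous (k + 1) p) (by omega))
    have hq : ∑ i, c i * f i ∈ boundedCombinations f (k + 1) := by
      refine ⟨c, rfl, fun i => ?_⟩
      rcases hcd i with h0 | h0
      · simp [h0]
      · exact (totalDegree_mul _ _).trans h0
    have hr : p - ∑ i, c i * f i ∈ restrictTotalDegree σ K k := by
      have : p - ∑ i, c i * f i = (p - homogeneousComponent (k + 1) p) -
          ∑ i, c i * (f i - homogeneousComponent (f i).totalDegree (f i)) := by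
        simp only [mul_sub, Finset.sum_sub_distrib, ← hc]
        ring
      rw [this]
      refine Submodule.sub_mem _ ?_ (Submodule.sum_mem _ fun i _ => ?_)
      · rw [mem_restrictTotalDegree]
        exact Nat.le_of_lt_succ (totalDegree_sub_homogeneousComponent_lt k.succ_pos hp)
      · rw [mem_restrictTotalDegree]
        rcases hcd i with h0 | h0
        · simp [h0]
        · have h1 := totalDegree_sub_homogeneousComponent_lt (hf i) le_rfl
          have h2 := totalDegree_mul (c i)
            (f i - homogeneousComponent (f i).totalDegree (f i))
          omega
    rw [← sub_add_cancel p (∑ i, c i * f i)]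
    refine Submodule.add_mem _ ?_ (Submodule.mem_sup_left hq)
    exact sup_le_sup_right (boundedCombinations_mono f k.le_succ) _ (ih hr)

/-- If the top-degree forms of `f` generate an ideal containing powers of all variables, then
membership in the ideal generated by `f` can be witnessed without cancellation of terms of
higher degree, as soon as the degree is large enough. -/
theorem exists_forall_mem_boundedCombinations (f : ι → MvPolynomial σ K)
    (hf : ∀ i, 0 < (f i).totalDegree) {M : ℕ} (hM : ∀ j, X j ^ M ∈ Ideal.span
      (Set.range fun i => homogeneousComponent (f i).totalDegree (f i))) :
    ∃ k₀, ∀ k ≥ k₀, ∀ p ∈ Ideal.span (Set.range f), p.totalDegree ≤ k →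
      p ∈ boundedCombinations f k := by
  set L := restrictTotalDegree σ K (Fintype.card σ * M)
  have hfg : L.FG := (Module.Finite.iff_fg).1 inferInstance
  have : IsNoetherian K L := isNoetherian_of_fg_of_noetherian L hfg
  obtain ⟨k₀, hk₀⟩ := exists_le_boundedCombinations f
    (S := (Ideal.span (Set.range f)).restrictScalars K ⊓ L)
    (Submodule.FG.of_le hfg inf_le_right) fun p hp => hp.1
  refine ⟨k₀, fun k hk p hpf hpk => ?_⟩
  obtain ⟨q, hq, r, hr, rfl⟩ := Submodule.mem_sup.1
    (restrictTotalDegree_le_sup f hf hM k ((mem_restrictTotalDegree _ _ _).2 hpk))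
  refine Submodule.add_mem _ hq (boundedCombinations_mono f hk (hk₀ ⟨?_, hr⟩))
  have := Ideal.sub_mem _ hpf (mem_span_of_mem_boundedCombinations hq)
  rwa [add_sub_cancel_left] at this

theorem finite_quotient_span (f : ι → MvPolynomial σ K)
    (hf : ∀ i, 0 < (f i).totalDegree) {M : ℕ} (hM : ∀ j, X j ^ M ∈ Ideal.span
      (Set.range fun i => homogeneousComponent (f i).totalDegree (f i))) :
    Module.Finite K (MvPolynomial σ K ⧸ Ideal.span (Set.range f)) := by
  set I := Ideal.span (Set.range f)
  refine Module.Finite.of_surjective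
    ((Ideal.Quotient.mkₐ K I).toLinearMap ∘ₗ
      (restrictTotalDegree σ K (Fintype.card σ * M)).subtype) fun x => ?_
  obtain ⟨p, rfl⟩ := Ideal.Quotient.mk_surjective x
  obtain ⟨q, hq, r, hr, hp⟩ := Submodule.mem_sup.1
    (restrictTotalDegree_le_sup f hf hM _ ((mem_restrictTotalDegree _ _ p).2 le_rfl))
  refine ⟨⟨r, hr⟩, ?_⟩
  have hqI : Ideal.Quotient.mk I q = 0 :=
    Ideal.Quotient.eq_zero_iff_mem.2 (mem_span_of_mem_boundedCombinations hq)
  simp [← hp, hqI]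

omit [Fintype ι] in
theorem finite_setOf_forall_eval_eq_zero (f : ι → MvPolynomial σ K)
    [Module.Finite K (MvPolynomial σ K ⧸ Ideal.span (Set.range f))] :
    {x : σ → K | ∀ i, eval x (f i) = 0}.Finite := by
  set I := Ideal.span (Set.range f)
  have hint : ∀ j : σ, ∃ q : Polynomial K, q ≠ 0 ∧ Polynomial.aeval (X j) q ∈ I := fun j => by
    obtain ⟨q, hq, hq0⟩ := Algebra.IsIntegral.isIntegral (R := K) (Ideal.Quotient.mk I (X j))
    refine ⟨q, hq.ne_zero, ?_⟩
    rw [← Ideal.Quotient.eq_zero_iff_mem, ← Ideal.Quotient.mkₐ_eq_mk K,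
      ← Polynomial.aeval_algHom_apply]
    exact hq0
  choose q hq0 hqI using hint
  classical
  refine (Set.Finite.pi fun j => (q j).roots.toFinset.finite_toSet).subset fun x hx => ?_
  rw [Set.mem_univ_pi]
  intro j
  rw [Finset.mem_coe, Multiset.mem_toFinset, Polynomial.mem_roots (hq0 j), Polynomial.IsRoot]
  have hle : I ≤ RingHom.ker (aeval x : MvPolynomial σ K →ₐ[K] K) := by
    rw [Ideal.span_le]
    rintro _ ⟨i, rfl⟩
    simpa [RingHom.mem_ker, aeval_eq_eval] using hx i
  have := hle (hqI j)
  rw [RingHom.mem_ker, ← Polynomial.aeval_algHom_apply, aeval_X] at this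
  simpa using this

end DegreeBounds

section SimpleZeros

variable {K σ : Type*} [Field K]

theorem exists_pow_mem_of_forall_eval_eq_zero [IsAlgClosed K] [Finite σ] {ι : Type*}
    {f : ι → MvPolynomial σ K} {p : MvPolynomial σ K}
    (hp : ∀ x : σ → K, (∀ i, eval x (f i) = 0) → eval x p = 0) :
    ∃ m, p ^ m ∈ Ideal.span (Set.range f) := by
  change p ∈ (Ideal.span (Set.range f)).radical
  rw [← vanishingIdeal_zeroLocus_eq_radical (K := K), zeroLocus_span]
  refine mem_vanishingIdeal_iff.2 fun x hx => ?_
  rw [aeval_eq_eval]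
  exact hp x fun i => by simpa [aeval_eq_eval] using hx _ (Set.mem_range_self i)

theorem exists_X_pow_mem [IsAlgClosed K] [Fintype σ] {ι : Type*}
    {f : ι → MvPolynomial σ K}
    (hf : ∀ x : σ → K, (∀ i, eval x (f i) = 0) → x = 0) :
    ∃ M, ∀ j, X j ^ M ∈ Ideal.span (Set.range f) := by
  choose m hm using fun j : σ => exists_pow_mem_of_forall_eval_eq_zero (f := f) (p := X j)
    fun x hx => by simp [hf x hx]
  exact ⟨Finset.univ.sup m, fun j => Ideal.pow_mem_of_pow_mem _ (hm j)
    (Finset.le_sup (Finset.mem_univ j))⟩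

variable [Fintype σ]

theorem exists_sub_C_eval_eq_sum (ξ : σ → K) (p : MvPolynomial σ K) :
    ∃ θ : σ → MvPolynomial σ K, p - C (eval ξ p) = ∑ j, θ j * (X j - C (ξ j)) := by
  suffices h : p - C (eval ξ p) ∈
      Ideal.span (Set.range fun j : σ => (X j - C (ξ j) : MvPolynomial σ K)) by
    obtain ⟨θ, hθ⟩ := (Ideal.mem_span_range_iff_exists_fun).1 h
    exact ⟨θ, hθ.symm⟩
  induction p using MvPolynomial.induction_on with
  | C a => simp
  | add p q hp hq =>
    have : p + q - C (eval ξ (p + q)) = (p - C (eval ξ p)) + (q - C (eval ξ q)) := by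
      simp only [map_add]
      ring
    rw [this]
    exact Ideal.add_mem _ hp hq
  | mul_X p j hp =>
    have : p * X j - C (eval ξ (p * X j)) =
        X j * (p - C (eval ξ p)) + C (eval ξ p) * (X j - C (ξ j)) := by
      simp only [map_mul, eval_X]
      ring
    rw [this]
    exact Ideal.add_mem _ (Ideal.mul_mem_left _ _ hp)
      (Ideal.mul_mem_left _ _ (Ideal.subset_span ⟨j, rfl⟩))

variable [DecidableEq σ]

theorem eval_det_pderiv (f : σ → MvPolynomial σ K) (x : σ → K) :
    eval x (Matrix.of fun i j => pderiv j (f i)).det =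
      (Matrix.of fun i j => eval x (pderiv j (f i))).det := by
  rw [RingHom.map_det]
  rfl

/-- A nonzero Jacobian at a common zero `ξ` gives a polynomial which, modulo the ideal of the
system, is supported at `ξ`. -/
theorem exists_eval_eq_one_mul_sub_C_mem (f : σ → MvPolynomial σ K) {ξ : σ → K}
    (hξ : ∀ i, eval ξ (f i) = 0)
    (hJ : eval ξ (Matrix.of fun i j => pderiv j (f i)).det ≠ 0) :
    ∃ e : MvPolynomial σ K, eval ξ e = 1 ∧
      ∀ p, e * (p - C (eval ξ p)) ∈ Ideal.span (Set.range f) := by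
  choose θ hθ using fun i => exists_sub_C_eval_eq_sum ξ (f i)
  simp only [hξ, map_zero, sub_zero] at hθ
  set T : Matrix σ σ (MvPolynomial σ K) := Matrix.of θ with hT
  have hTf : T.mulVec (fun j => X j - C (ξ j)) = f := by
    ext1 i
    simp [Matrix.mulVec, dotProduct, hT, ← hθ i]
  have hTJ : eval ξ T.det = eval ξ (Matrix.of fun i j => pderiv j (f i)).det := by
    rw [eval_det_pderiv, RingHom.map_det]
    congr 1
    ext i j
    rw [Matrix.of_apply, hθ i]
    simp [hT, pderiv_X, Pi.single_apply, Derivation.leibniz, apply_ite (eval ξ)]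
  have hmem : ∀ j, T.det * (X j - C (ξ j)) ∈ Ideal.span (Set.range f) := fun j => by
    have h1 : T.adjugate.mulVec f = T.det • fun j => X j - C (ξ j) := by
      rw [← hTf, Matrix.mulVec_mulVec, Matrix.adjugate_mul, Matrix.smul_mulVec,
        Matrix.one_mulVec]
    have h2 := congrFun h1 j
    rw [Pi.smul_apply, smul_eq_mul] at h2
    rw [← h2]
    exact Ideal.sum_mem _ fun i _ =>
      Ideal.mul_mem_left _ _ (Ideal.subset_span (Set.mem_range_self i))
  refine ⟨C (eval ξ T.det)⁻¹ * T.det, ?_, fun p => ?_⟩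
  · rw [map_mul, eval_C, inv_mul_cancel₀ (hTJ ▸ hJ)]
  · obtain ⟨c, hc⟩ := exists_sub_C_eval_eq_sum ξ p
    rw [hc, mul_assoc, Finset.mul_sum]
    refine Ideal.mul_mem_left _ _ (Ideal.sum_mem _ fun j _ => ?_)
    rw [mul_left_comm]
    exact Ideal.mul_mem_left _ _ (hmem j)

/-- A system with finitely many zeros, all simple, generates a radical ideal. -/
theorem mem_span_of_simple_zeros [IsAlgClosed K] (f : σ → MvPolynomial σ K)
    (hfin : {x : σ → K | ∀ i, eval x (f i) = 0}.Finite)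
    (hsimple : ∀ x : σ → K, (∀ i, eval x (f i) = 0) →
      eval x (Matrix.of fun i j => pderiv j (f i)).det ≠ 0)
    {p : MvPolynomial σ K} (hp : ∀ x : σ → K, (∀ i, eval x (f i) = 0) → eval x p = 0) :
    p ∈ Ideal.span (Set.range f) := by
  classical
  set I := Ideal.span (Set.range f)
  have hI : ∀ q ∈ I, ∀ x : σ → K, (∀ i, eval x (f i) = 0) → eval x q = 0 := fun q hq x hx => by
    have hle : I ≤ RingHom.ker (eval x) := by
      rw [Ideal.span_le]
      rintro _ ⟨i, rfl⟩
      exact hx i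
    exact hle hq
  have hex : ∀ ξ : σ → K, ∃ e : MvPolynomial σ K, (∀ i, eval ξ (f i) = 0) →
      eval ξ e = 1 ∧ ∀ p, e * (p - C (eval ξ p)) ∈ I := fun ξ => by
    by_cases hξ : ∀ i, eval ξ (f i) = 0
    · obtain ⟨e, he⟩ := exists_eval_eq_one_mul_sub_C_mem f hξ (hsimple ξ hξ)
      exact ⟨e, fun _ => he⟩
    · exact ⟨0, fun h => absurd h hξ⟩
  choose e he using hex
  have hV : ∀ x, x ∈ hfin.toFinset ↔ ∀ i, eval x (f i) = 0 := by simp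
  have hone : ∀ x : σ → K, (∀ i, eval x (f i) = 0) →
      eval x (1 - ∑ ξ ∈ hfin.toFinset, e ξ) = 0 := fun x hx => by
    have hne : ∀ ξ ∈ hfin.toFinset, ξ ≠ x → eval x (e ξ) = 0 := fun ξ hξ hne => by
      obtain ⟨j, hj⟩ := Function.ne_iff.1 hne
      have := hI _ ((he ξ ((hV ξ).1 hξ)).2 (X j)) x hx
      simp only [map_mul, map_sub, eval_X, eval_C, mul_eq_zero, sub_eq_zero] at this
      exact this.resolve_right (Ne.symm hj)
    rw [map_sub, map_one, map_sum, Finset.sum_eq_single_of_mem x ((hV x).2 hx) hne,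
      (he x hx).1, sub_self]
  obtain ⟨m, hm⟩ := exists_pow_mem_of_forall_eval_eq_zero hone
  have hann : ∀ ξ ∈ hfin.toFinset, ∀ q : MvPolynomial σ K,
      (∀ x : σ → K, (∀ i, eval x (f i) = 0) → eval x q = 0) → e ξ * q ∈ I :=
    fun ξ hξ q hq => by
      have := (he ξ ((hV ξ).1 hξ)).2 q
      rwa [hq ξ ((hV ξ).1 hξ), map_zero, sub_zero] at this
  have hsum : (∑ ξ ∈ hfin.toFinset, e ξ) * p ∈ I := by
    rw [Finset.sum_mul]
    exact Ideal.sum_mem _ fun ξ hξ => hann ξ hξ p hp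
  have hiter : ∀ m : ℕ, p - (1 - ∑ ξ ∈ hfin.toFinset, e ξ) ^ m * p ∈ I := fun m => by
    induction m with
    | zero => simp
    | succ m ih =>
      have : p - (1 - ∑ ξ ∈ hfin.toFinset, e ξ) ^ (m + 1) * p =
          (p - (1 - ∑ ξ ∈ hfin.toFinset, e ξ) ^ m * p) +
          (1 - ∑ ξ ∈ hfin.toFinset, e ξ) ^ m * ((∑ ξ ∈ hfin.toFinset, e ξ) * p) := by
        ring
      rw [this]
      exact Ideal.add_mem _ ih (Ideal.mul_mem_left _ _ hsum)
  have := Ideal.add_mem _ (hiter m) (Ideal.mul_mem_right p _ hm)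
  rwa [sub_add_cancel] at this

end SimpleZeros

section Residue

variable {K σ : Type*} [Field K] [Fintype σ] [DecidableEq σ] [DecidableEq K]

omit [Fintype σ] [DecidableEq σ] in
theorem _root_.Lagrange.sum_pow_div_prod_sub_eq_zero (R : Finset K) {a : ℕ}
    (ha : a + 1 < R.card) : ∑ r ∈ R, r ^ a / ∏ t ∈ R.erase r, (r - t) = 0 := by
  have h := Lagrange.coeff_eq_sum (s := R) (v := id) Function.injective_id.injOn
    (P := Polynomial.X ^ a) (by rw [Polynomial.degree_X_pow]; norm_cast; omega)
  rw [Polynomial.coeff_X_pow, if_neg (by omega)] at h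
  simpa using h.symm

/-- The Euler–Jacobi formula for a system of univariate polynomials with the same simple roots. -/
theorem sum_piFinset_eval_div_prod_eq_zero (R : Finset K)
    {p : MvPolynomial σ K}
    (hp : p.totalDegree + Fintype.card σ < Fintype.card σ * R.card) :
    ∑ η ∈ Fintype.piFinset fun _ : σ => R,
      eval η p / ∏ j, ∏ t ∈ R.erase (η j), (η j - t) = 0 := by
  simp only [eval_eq', Finset.sum_div]
  rw [Finset.sum_comm]
  refine Finset.sum_eq_zero fun s hs => ?_
  obtain ⟨j, hj⟩ : ∃ j, s j + 1 < R.card := by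
    by_contra! hle
    have h1 := Finset.sum_le_sum fun j (_ : j ∈ Finset.univ) => hle j
    have h2 := le_totalDegree hs
    rw [Finsupp.sum_fintype _ _ fun _ => rfl] at h2
    simp only [Finset.sum_const, Finset.card_univ, smul_eq_mul, Finset.sum_add_distrib,
      mul_one] at h1
    omega
  simp only [mul_div_assoc, ← Finset.mul_sum, ← Finset.prod_div_distrib]
  rw [← Finset.prod_univ_sum (fun _ => R)
    (fun j r => r ^ s j / ∏ t ∈ R.erase r, (r - t)),
    Finset.prod_eq_zero (Finset.mem_univ j) (Lagrange.sum_pow_div_prod_sub_eq_zero R hj),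
    mul_zero]

omit [Fintype σ] in
theorem eval_pderiv_prod_X_sub_C (R : Finset K) {η : σ → K} {j : σ} (hη : η j ∈ R) (l : σ) :
    eval η (pderiv l (∏ t ∈ R, (X j - C t))) =
      if j = l then ∏ t ∈ R.erase (η j), (η j - t) else 0 := by
  have h1 : (∏ t ∈ R, (X j - C t) : MvPolynomial σ K) =
      Polynomial.aeval (X j) (Lagrange.nodal R id) := by
    simp [Lagrange.nodal, map_prod, algebraMap_eq]
  have h2 : eval η (Polynomial.aeval (X j : MvPolynomial σ K)
      (Polynomial.derivative (Lagrange.nodal R id))) = ∏ t ∈ R.erase (η j), (η j - t) := by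
    rw [← coe_aeval_eq_eval, RingHom.coe_coe, ← Polynomial.aeval_algHom_apply, aeval_X,
      Polynomial.coe_aeval_eq_eval]
    have := Lagrange.eval_nodal_derivative_eval_node_eq (v := id) hη
    rw [id, Lagrange.eval_nodal] at this
    exact this
  rw [h1, Derivation.map_aeval, smul_eq_mul, map_mul, h2, pderiv_X, Pi.single_apply]
  split_ifs <;> simp

omit [DecidableEq K] in
theorem totalDegree_det_add_le {A : Matrix σ σ (MvPolynomial σ K)} {d : σ → ℕ} {N : ℕ}
    (hA : ∀ j i, (A j i).totalDegree + d i ≤ N) :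
    A.det.totalDegree + ∑ i, d i ≤ Fintype.card σ * N := by
  have hd : ∑ i, d i ≤ Fintype.card σ * N := by
    have := Finset.sum_le_sum fun i (_ : i ∈ Finset.univ) => (Nat.le_add_left _ _).trans (hA i i)
    simpa using this
  suffices A.det ∈ restrictTotalDegree σ K (Fintype.card σ * N - ∑ i, d i) by
    rw [mem_restrictTotalDegree] at this
    omega
  rw [Matrix.det_apply]
  refine Submodule.sum_mem _ fun π _ => ?_
  rw [Units.smul_def]
  refine zsmul_mem ((mem_restrictTotalDegree _ _ _).2 ?_) _
  have h1 := totalDegree_finsetProd Finset.univ fun i => A (π i) i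
  have h2 := Finset.sum_le_sum fun i (_ : i ∈ Finset.univ) => hA (π i) i
  simp only [Finset.sum_add_distrib, Finset.sum_const, Finset.card_univ, smul_eq_mul] at h2
  omega

/-- The Euler–Jacobi formula, given univariate polynomials in the ideal of the system with simple
roots, together with degree-controlled witnesses of membership. -/
theorem finsum_eval_div_jacobian_eq_zero (f : σ → MvPolynomial σ K)
    (R : Finset K) (A : Matrix σ σ (MvPolynomial σ K))
    (hA : ∀ j, ∏ t ∈ R, (X j - C t) = ∑ i, A j i * f i)
    (hAdeg : ∀ j i, (A j i).totalDegree + (f i).totalDegree ≤ R.card)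
    (h : MvPolynomial σ K)
    (hdeg : h.totalDegree + Fintype.card σ < ∑ i, (f i).totalDegree) :
    ∑ᶠ ξ ∈ {x : σ → K | ∀ i, eval x (f i) = 0},
      eval ξ h / eval ξ (Matrix.of fun i j => pderiv j (f i)).det = 0 := by
  have hdet := totalDegree_det_add_le hAdeg
  have hgrid : ∀ (η : σ → K), (∀ i, eval η (f i) = 0) → ∀ j, η j ∈ R := fun η hη j => by
    have := congrArg (eval η) (hA j)
    simp only [map_prod, map_sum, map_mul, hη, mul_zero, Finset.sum_const_zero,
      Finset.prod_eq_zero_iff, map_sub, eval_X, eval_C, sub_eq_zero] at this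
    obtain ⟨t, ht, htη⟩ := this
    rwa [htη]
  have hprod : ∀ η : σ → K, (∏ j, ∏ t ∈ R.erase (η j), (η j - t)) ≠ 0 := fun η =>
    Finset.prod_ne_zero_iff.2 fun j _ => Finset.prod_ne_zero_iff.2 fun t ht =>
      sub_ne_zero.2 (Finset.ne_of_mem_erase ht).symm
  have hjac : ∀ η : σ → K, (∀ i, eval η (f i) = 0) →
      ∏ j, ∏ t ∈ R.erase (η j), (η j - t) =
        eval η A.det * eval η (Matrix.of fun i j => pderiv j (f i)).det := fun η hη => by
    rw [← Matrix.det_diagonal, eval_det_pderiv, RingHom.map_det, ← Matrix.det_mul]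
    congr 1
    ext j l
    rw [Matrix.diagonal_apply, ← eval_pderiv_prod_X_sub_C R (hgrid η hη j), hA j]
    simp [Matrix.mul_apply, Derivation.leibniz, hη]
  have hzero : ∀ η : σ → K, (∀ j, η j ∈ R) → (¬ ∀ i, eval η (f i) = 0) →
      eval η A.det = 0 := fun η hη hf => by
    rw [RingHom.map_det]
    by_contra hne
    refine hf (congrFun (Matrix.eq_zero_of_mulVec_eq_zero hne
      (v := fun i => eval η (f i)) ?_))
    ext1 j
    have := congrArg (eval η) (hA j)
    rw [map_prod, Finset.prod_eq_zero (hη j) (by simp), map_sum] at this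
    simpa [Matrix.mulVec, dotProduct] using this.symm
  have hterm : ∀ η ∈ {x : σ → K | ∀ i, eval x (f i) = 0},
      eval η h / eval η (Matrix.of fun i j => pderiv j (f i)).det =
        eval η (h * A.det) / ∏ j, ∏ t ∈ R.erase (η j), (η j - t) := fun η hη => by
    have := hprod η
    rw [hjac η hη] at this ⊢
    rw [map_mul, mul_comm (eval η A.det), mul_div_mul_right _ _ (left_ne_zero_of_mul this)]
  rw [finsum_mem_congr rfl hterm, finsum_mem_inter_support_eq' _ _
    (Fintype.piFinset fun _ : σ => R : Set (σ → K)), finsum_mem_coe_finset]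
  · refine sum_piFinset_eval_div_prod_eq_zero R ?_
    have := totalDegree_mul h A.det
    omega
  · intro η hη
    rw [Finset.mem_coe, Fintype.mem_piFinset]
    refine ⟨hgrid η, fun hR => ?_⟩
    by_contra hf
    rw [Function.mem_support, map_mul, hzero η hR hf, mul_zero, zero_div] at hη
    exact hη rfl

end Residue

end MvPolynomial

/-- Euler–Jacobi formula: if `f_1,…,f_n ∈ ℂ[x_1,…,x_n]` have no zeros at infinity (their
top-degree homogeneous parts only vanish simultaneously at the origin) and all their common
zeros are simple (the Jacobian `J_f` does not vanish there), then for every polynomial `h`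
with `deg h < Σ deg f_i − n`, the global residue `Σ_{ξ ∈ V(f)} h(ξ)/J_f(ξ)` is zero. -/
theorem eulerJacobi_formula {n : ℕ} (f : Fin n → MvPolynomial (Fin n) ℂ)
    (hinf : ∀ x : Fin n → ℂ,
      (∀ i, eval x (homogeneousComponent (f i).totalDegree (f i)) = 0) → x = 0)
    (hsimple : ∀ x : Fin n → ℂ, (∀ i, eval x (f i) = 0) →
      eval x (Matrix.of fun i j => pderiv j (f i)).det ≠ 0)
    (h : MvPolynomial (Fin n) ℂ)
    (hdeg : h.totalDegree < (∑ i, (f i).totalDegree) - n) :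
    ∑ᶠ ξ ∈ {x : Fin n → ℂ | ∀ i, eval x (f i) = 0},
      eval ξ h / eval ξ (Matrix.of fun i j => pderiv j (f i)).det = 0 := by
  classical
  rcases Set.eq_empty_or_nonempty {x : Fin n → ℂ | ∀ i, eval x (f i) = 0} with
    hempty | ⟨x₀, hx₀⟩
  · rw [hempty, finsum_mem_empty]
  have hf : ∀ i, 0 < (f i).totalDegree := fun i => by
    by_contra hi
    have hC := totalDegree_eq_zero_iff_eq_C.1 (Nat.le_zero.1 (not_lt.1 hi))
    refine hsimple x₀ hx₀ ?_
    rw [Matrix.det_eq_zero_of_row_eq_zero i fun j => ?_, map_zero]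
    rw [Matrix.of_apply, hC, pderiv_C]
  obtain ⟨M, hM⟩ := exists_X_pow_mem hinf
  have := finite_quotient_span f hf hM
  have hfin := finite_setOf_forall_eval_eq_zero f
  obtain ⟨k₀, hk₀⟩ := exists_forall_mem_boundedCombinations f hf hM
  obtain ⟨R, hVR, hR⟩ := Infinite.exists_superset_card_eq
    (hfin.toFinset.biUnion fun ξ => Finset.univ.image ξ)
    ((hfin.toFinset.biUnion fun ξ => Finset.univ.image ξ).card + k₀ +
      ∑ i, (f i).totalDegree) (by omega)
  have hmem : ∀ j, (∏ t ∈ R, (X j - C t) : MvPolynomial (Fin n) ℂ) ∈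
      boundedCombinations f R.card := fun j => by
    refine hk₀ _ (by omega) _ (mem_span_of_simple_zeros f hfin hsimple fun x hx => ?_) ?_
    · rw [map_prod]
      refine Finset.prod_eq_zero (i := x j) (hVR ?_) (by simp)
      exact Finset.mem_biUnion.2
        ⟨x, hfin.mem_toFinset.2 hx, Finset.mem_image_of_mem x (Finset.mem_univ j)⟩
    · refine (totalDegree_finsetProd _ _).trans ?_
      simpa using Finset.sum_le_card_nsmul R _ 1 fun t _ =>
        (totalDegree_sub_C_le (X j : MvPolynomial (Fin n) ℂ) t).trans (totalDegree_X j).le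
  choose A hA hAdeg using hmem
  refine finsum_eval_div_jacobian_eq_zero f R A hA (fun j i => ?_) h ?_
  · by_cases hA0 : A j i = 0
    · have := Finset.single_le_sum (f := fun i => (f i).totalDegree)
        (fun _ _ => Nat.zero_le _) (Finset.mem_univ i)
      rw [hA0, totalDegree_zero]
      omega
    · have hf0 : f i ≠ 0 := fun h0 => by simpa [h0] using hf i
      rw [← totalDegree_mul_of_isDomain hA0 hf0]
      exact hAdeg j i
  · rw [Fintype.card_fin]
    omega
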